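/- Suppose Assumption 1 holds, the inverse demand function is affine, p(q) = max{b − aq, 0} with a, b > 0, and b > min_n C_n'(0). Let x be a Cournot equilibrium with aggregate supply X, let α_n = C_n'(x_n), and let β = aX/(b − min_n α_n). If X > b/a, then x is socially optimal. If X ≤ b/a, then: (a) 1/2 ≤ β < 1, and (b) the efficiency of x satisfies γ(x) ≥ g(β) = 3β² − 4β + 2. -/

import Mathlib

open Finset Set

noncomputable section

/-- Assumption 1: the cost function `C` (with derivative `C'`) is convex, continuous,
nondecreasing on `[0,∞)`, continuously differentiable on `(0,∞)`, has right derivative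
`C' 0` at `0`, and `C 0 = 0`. -/
def CostAssumption (C C' : ℝ → ℝ) : Prop :=
  ConvexOn ℝ (Set.Ici 0) C ∧
  ContinuousOn C (Set.Ici 0) ∧
  MonotoneOn C (Set.Ici 0) ∧
  (∀ x : ℝ, 0 < x → HasDerivAt C (C' x) x) ∧
  ContinuousOn C' (Set.Ioi 0) ∧
  HasDerivWithinAt C (C' 0) (Set.Ici 0) 0 ∧
  C 0 = 0

/-- Assumption 2: the inverse demand function `p` is continuous, nonnegative and
nonincreasing on `[0,∞)`, with `p 0 > 0`; `pr q` is the right derivative of `p`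
at every `q ≥ 0` and `pl q` is the left derivative of `p` at every `q > 0`. -/
def DemandAssumption (p pl pr : ℝ → ℝ) : Prop :=
  ContinuousOn p (Set.Ici 0) ∧
  (∀ q : ℝ, 0 ≤ q → 0 ≤ p q) ∧
  AntitoneOn p (Set.Ici 0) ∧
  0 < p 0 ∧
  HasDerivWithinAt p (pr 0) (Set.Ici 0) 0 ∧
  (∀ q : ℝ, 0 < q → HasDerivWithinAt p (pr q) (Set.Ici q) q) ∧
  (∀ q : ℝ, 0 < q → HasDerivWithinAt p (pl q) (Set.Iic q) q)

/-- The social welfare of the supply vector `x`. -/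
def SW {N : ℕ} (C : Fin N → ℝ → ℝ) (p : ℝ → ℝ) (x : Fin N → ℝ) : ℝ :=
  (∫ q in (0:ℝ)..(∑ n, x n), p q) - ∑ n, C n (x n)

/-- A social optimum: a nonnegative vector maximizing the social welfare. -/
def SocialOptimum {N : ℕ} (C : Fin N → ℝ → ℝ) (p : ℝ → ℝ) (x : Fin N → ℝ) : Prop :=
  (∀ n, 0 ≤ x n) ∧ ∀ y : Fin N → ℝ, (∀ n, 0 ≤ y n) → SW C p y ≤ SW C p x

/-- A Cournot candidate: a nonnegative vector satisfying the first-order necessary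
conditions for a Cournot equilibrium. -/
def CournotCandidate {N : ℕ} (C' : Fin N → ℝ → ℝ) (p pl pr : ℝ → ℝ)
    (x : Fin N → ℝ) : Prop :=
  (∀ n, 0 ≤ x n) ∧
  ∀ n, (0 < x n → C' n (x n) ≤ p (∑ m, x m) + x n * pl (∑ m, x m)) ∧
       p (∑ m, x m) + x n * pr (∑ m, x m) ≤ C' n (x n)

/-- A Cournot equilibrium: each supplier's quantity is a best response. -/
def CournotEquilibrium {N : ℕ} (C : Fin N → ℝ → ℝ) (p : ℝ → ℝ) (x : Fin N → ℝ) : Prop :=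
  (∀ n, 0 ≤ x n) ∧
  ∀ n, ∀ z : ℝ, 0 ≤ z →
    z * p (z + ∑ m ∈ Finset.univ.erase n, x m) - C n z ≤
      x n * p (x n + ∑ m ∈ Finset.univ.erase n, x m) - C n (x n)

/-- A monopoly output: a nonnegative vector maximizing total profit. -/
def MonopolyOutput {N : ℕ} (C : Fin N → ℝ → ℝ) (p : ℝ → ℝ) (x : Fin N → ℝ) : Prop :=
  (∀ n, 0 ≤ x n) ∧
  ∀ y : Fin N → ℝ, (∀ n, 0 ≤ y n) →
    p (∑ n, y n) * (∑ n, y n) - ∑ n, C n (y n) ≤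
      p (∑ n, x n) * (∑ n, x n) - ∑ n, C n (x n)

/-- The quantity `φ` appearing in the efficiency bound `f`. -/
def phi (c : ℝ) : ℝ := max ((2 - c + Real.sqrt (c ^ 2 - 4 * c + 12)) / 2) 1

/-- The efficiency lower bound `f(c̄) = (φ² + 2)/(φ² + 2φ + c̄)`. -/
def fbound (c : ℝ) : ℝ := (phi c ^ 2 + 2) / (phi c ^ 2 + 2 * phi c + c)

lemma aux_tangent {C C' : ℝ → ℝ} (h : CostAssumption C C') {x y : ℝ} (hx : 0 ≤ x) (hy : 0 ≤ y) :
    C x + C' x * (y - x) ≤ C y := by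
  obtain ⟨hc, -, -, hd, -, h0, -⟩ := h
  rcases lt_trichotomy x y with hxy | hxy | hxy
  · have h1 : C' x ≤ slope C x y := by
      have hd' : HasDerivWithinAt C (C' x) (Set.Ici x) x := by
        rcases hx.eq_or_lt with h | h
        · subst h; exact h0
        · exact (hd x h).hasDerivWithinAt
      exact hc.le_slope_of_hasDerivWithinAt_Ioi hx hy hxy (hd'.mono Set.Ioi_subset_Ici_self)
    rw [slope_def_field, le_div_iff₀ (by linarith)] at h1
    linarith
  · subst hxy; simp
  · have h1 : slope C y x ≤ C' x :=
      hc.slope_le_of_hasDerivAt hy hx hxy (hd x (by linarith))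
    rw [slope_def_field, div_le_iff₀ (by linarith)] at h1
    linarith

lemma aux_int1 {a b Y : ℝ} (ha : 0 < a) (hY : 0 ≤ Y) (hYb : Y ≤ b / a) :
    ∫ q in (0:ℝ)..Y, max (b - a * q) 0 = b * Y - a * Y ^ 2 / 2 := by
  have h1 : ∫ q in (0:ℝ)..Y, max (b - a * q) 0 = ∫ q in (0:ℝ)..Y, (b - a * q) := by
    apply intervalIntegral.integral_congr
    intro q hq
    rw [Set.uIcc_of_le hY] at hq
    have : q * a ≤ b := (le_div_iff₀ ha).1 (hq.2.trans hYb)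
    exact max_eq_left (by linarith)
  rw [h1, intervalIntegral.integral_sub (by simp) (by apply Continuous.intervalIntegrable; fun_prop),
    intervalIntegral.integral_const_mul, integral_id, intervalIntegral.integral_const, smul_eq_mul]
  ring

lemma aux_int2 {a b Y : ℝ} (ha : 0 < a) (hb : 0 < b) (hYb : b / a ≤ Y) :
    ∫ q in (0:ℝ)..Y, max (b - a * q) 0 = b * (b / a) - a * (b / a) ^ 2 / 2 := by
  have h0 : 0 ≤ b / a := by positivity
  have hI : ∀ u v, IntervalIntegrable (fun q => max (b - a * q) 0) MeasureTheory.volume u v := by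
    intro u v
    apply Continuous.intervalIntegrable; fun_prop
  rw [← intervalIntegral.integral_add_adjacent_intervals (hI 0 (b/a)) (hI (b/a) Y),
    aux_int1 ha h0 le_rfl]
  have h1 : ∫ q in (b/a)..Y, max (b - a * q) 0 = ∫ q in (b/a)..Y, (0:ℝ) := by
    apply intervalIntegral.integral_congr
    intro q hq
    rw [Set.uIcc_of_le hYb] at hq
    have : b ≤ q * a := (div_le_iff₀ ha).1 hq.1
    exact max_eq_right (by linarith)
  rw [h1]; simp

lemma aux_int_le {a b Y m : ℝ} (ha : 0 < a) (hb : 0 < b) (hY : 0 ≤ Y) (hm : 0 ≤ m) :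
    (∫ q in (0:ℝ)..Y, max (b - a * q) 0) - m * Y ≤ (b - m) ^ 2 / (2 * a) := by
  have key : ∀ Z : ℝ, b * Z - a * Z ^ 2 / 2 - m * Z ≤ (b - m) ^ 2 / (2 * a) := by
    intro Z
    rw [le_div_iff₀ (by positivity)]
    nlinarith [sq_nonneg (a * Z - (b - m))]
  rcases le_total Y (b / a) with h | h
  · rw [aux_int1 ha hY h]; exact key Y
  · rw [aux_int2 ha hb h]
    have := key (b / a)
    have := mul_le_mul_of_nonneg_left h hm
    linarith

lemma aux_foc_pos {C C' : ℝ → ℝ} (h : CostAssumption C C') {a b s u : ℝ} (hu : 0 < u)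
    (hmax : ∀ z, 0 ≤ z → z * (b - a * (z + s)) - C z ≤ u * (b - a * (u + s)) - C u) :
    C' u = b - a * (u + s) - a * u := by
  have hd := h.2.2.2.1 u hu
  have hloc : IsLocalMax (fun z => z * (b - a * (z + s)) - C z) u := by
    filter_upwards [lt_mem_nhds hu] with z hz
    exact hmax z hz.le
  have hder : HasDerivAt (fun z => z * (b - a * (z + s)) - C z)
      ((1 * (b - a * (u + s)) + u * (-(a * 1))) - C' u) u := by
    apply HasDerivAt.sub _ hd
    apply HasDerivAt.mul (hasDerivAt_id u)
    exact (((hasDerivAt_id u).add_const s).const_mul a).const_sub b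
  have := hloc.hasDerivAt_eq_zero hder
  linarith

lemma aux_foc_zero {C C' : ℝ → ℝ} (h : CostAssumption C C') {a b s : ℝ}
    (hmax : ∀ z, 0 ≤ z → z * (b - a * (z + s)) - C z ≤ 0) :
    b - a * s ≤ C' 0 := by
  obtain ⟨-, -, -, -, -, h0, hz⟩ := h
  have h1 : HasDerivWithinAt C (C' 0) (Set.Ioi 0) 0 := h0.mono Set.Ioi_subset_Ici_self
  rw [hasDerivWithinAt_iff_tendsto_slope' (by simp)] at h1
  have h2 : Filter.Tendsto (fun z : ℝ => b - a * (z + s)) (nhdsWithin 0 (Set.Ioi 0))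
      (nhds (b - a * s)) := by
    have : Continuous (fun z : ℝ => b - a * (z + s)) := by fun_prop
    have h3 := this.tendsto 0
    simp only [zero_add] at h3
    exact h3.mono_left nhdsWithin_le_nhds
  refine le_of_tendsto_of_tendsto h2 h1 ?_
  filter_upwards [self_mem_nhdsWithin] with z hz'
  have hz' : 0 < z := hz'
  have := hmax z hz'.le
  rw [slope_def_field, hz, le_div_iff₀ (by linarith)]
  linarith

/-- Efficiency of Cournot equilibria under affine inverse demand
`p(q) = max (b - a q) 0`. -/
theorem affine_demand_efficiency {N : ℕ} (hN : 0 < N)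
    (C C' : Fin N → ℝ → ℝ) (a b : ℝ) (ha : 0 < a) (hb : 0 < b)
    (hC : ∀ n, CostAssumption (C n) (C' n))
    (p : ℝ → ℝ) (hp : p = fun q => max (b - a * q) 0)
    (hA4 : ∃ n, C' n 0 < b)
    (x : Fin N → ℝ) (hx : CournotEquilibrium C p x)
    (α : Fin N → ℝ) (hα : ∀ n, α n = C' n (x n))
    (β : ℝ) (hβ : β = a * (∑ n, x n) / (b - ⨅ n, α n)) :
    (b / a < (∑ n, x n) → SocialOptimum C p x) ∧
    ((∑ n, x n) ≤ b / a →
      (1 / 2 ≤ β ∧ β < 1) ∧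
      ∀ xS : Fin N → ℝ, SocialOptimum C p xS →
        3 * β ^ 2 - 4 * β + 2 ≤ SW C p x / SW C p xS) := by
  subst hp
  obtain ⟨hx0, hxm⟩ := hx
  have : Nonempty (Fin N) := ⟨⟨0, hN⟩⟩
  have hsplit : ∀ n, x n + ∑ m ∈ Finset.univ.erase n, x m = ∑ m, x m := fun n =>
    Finset.add_sum_erase _ _ (Finset.mem_univ n)
  set X := ∑ n, x n with hX
  have hX0 : 0 ≤ X := Finset.sum_nonneg fun n _ => hx0 n
  have hC0 : ∀ n, C n 0 = 0 := fun n => (hC n).2.2.2.2.2.2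
  have hCnn : ∀ n y, 0 ≤ y → 0 ≤ C n y := by
    intro n y hy
    rw [← hC0 n]
    exact (hC n).2.2.1 (Set.mem_Ici.2 le_rfl) hy hy
  -- zero price forces zero cost
  have hzero : b / a ≤ X → ∀ n, C n (x n) = 0 := by
    intro h n
    have h1 := hxm n 0 le_rfl
    rw [hsplit n] at h1
    have h2 : b ≤ X * a := (div_le_iff₀ ha).1 h
    have h3 : max (b - a * X) 0 = 0 := max_eq_right (by linarith)
    simp only [h3, hC0 n] at h1
    have := hCnn n _ (hx0 n)
    linarith
  constructor
  · intro h
    refine ⟨hx0, fun y hy => ?_⟩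
    have hY0 : 0 ≤ ∑ n, y n := Finset.sum_nonneg fun n _ => hy n
    unfold SW
    rw [← hX, aux_int2 ha hb h.le, Finset.sum_eq_zero (fun n _ => hzero h.le n)]
    have h1 := aux_int_le (m := 0) ha hb hY0 le_rfl
    have h2 : 0 ≤ ∑ n, C n (y n) := Finset.sum_nonneg fun n _ => hCnn n _ (hy n)
    have h3 : b * (b / a) - a * (b / a) ^ 2 / 2 = (b - 0) ^ 2 / (2 * a) := by
      field_simp; ring
    linarith
  intro hXle
  obtain ⟨k, -, hk⟩ := Finset.exists_max_image Finset.univ x ⟨⟨0, hN⟩, Finset.mem_univ _⟩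
  have hk : ∀ n, x n ≤ x k := fun n => hk n (Finset.mem_univ n)
  have hXpos_k : 0 < X → 0 < x k := by
    intro h
    by_contra hc
    have : X ≤ 0 := Finset.sum_nonpos fun n _ => (hk n).trans (not_lt.1 hc)
    linarith
  have hXlt : X < b / a := by
    rcases hXle.lt_or_eq with h | h
    · exact h
    exfalso
    have hxk : 0 < x k := hXpos_k (by rw [h]; positivity)
    have h0 := hzero h.ge k
    have h1 := hxm k (x k / 2) (by linarith)
    have h2 : C k (x k / 2) ≤ C k (x k) :=
      (hC k).2.2.1 (Set.mem_Ici.2 (by linarith)) (Set.mem_Ici.2 hxk.le) (by linarith)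
    have h3 : b = X * a := by rw [h]; field_simp
    have h4 := hsplit k
    rw [h4] at h1
    have h5 : max (b - a * X) 0 = 0 := max_eq_right (by linarith)
    have h6 : x k / 2 + ∑ m ∈ Finset.univ.erase k, x m = X - x k / 2 := by linarith
    simp only [h6, h5] at h1
    have h7 := le_max_left (b - a * (X - x k / 2)) 0
    have h8 := mul_le_mul_of_nonneg_left h7 (by linarith : 0 ≤ x k / 2)
    have h9 : 0 < a * (x k * x k) := by positivity
    rw [h3] at h8 h1
    nlinarith
  have haX : X * a < b := (lt_div_iff₀ ha).1 hXlt
  have hbest : ∀ n z, 0 ≤ z → z * (b - a * (z + ∑ m ∈ Finset.univ.erase n, x m)) - C n z ≤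
      x n * (b - a * (x n + ∑ m ∈ Finset.univ.erase n, x m)) - C n (x n) := by
    intro n z hz
    have h1 := hxm n z hz
    have h3 : max (b - a * X) 0 = b - a * X := max_eq_left (by linarith)
    rw [hsplit n] at h1 ⊢
    simp only [h3] at h1
    have := mul_le_mul_of_nonneg_left (le_max_left (b - a * (z + ∑ m ∈ Finset.univ.erase n, x m)) 0) hz
    linarith
  have hpos : ∀ n, 0 < x n → α n = b - a * X - a * x n := by
    intro n hn
    rw [hα, aux_foc_pos (hC n) hn (hbest n), hsplit n]
  have hzer : ∀ n, x n = 0 → b - a * X ≤ α n := by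
    intro n hn
    have h1 := aux_foc_zero (hC n) (a := a) (b := b) (s := ∑ m ∈ Finset.univ.erase n, x m) (by
      intro z hz
      have := hbest n z hz
      rw [hn, hC0 n] at this
      linarith)
    have h2 := hsplit n
    rw [hn, zero_add] at h2
    rw [h2] at h1
    rw [hα, hn]
    exact h1
  have hXpos : 0 < X := by
    rcases hX0.eq_or_lt with h | h
    · exfalso
      obtain ⟨n, hn⟩ := hA4
      have hn0 : x n = 0 := by
        have := Finset.single_le_sum (fun i _ => hx0 i) (Finset.mem_univ n)
        exact le_antisymm (by linarith) (hx0 n)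
      have := hzer n hn0
      rw [hα, hn0, ← h] at this
      linarith
    · exact h
  have hxk := hXpos_k hXpos
  have hαge : ∀ n, b - a * X - a * x n ≤ α n := by
    intro n
    rcases (hx0 n).eq_or_lt with h | h
    · have := hzer n h.symm
      rw [← h]; linarith
    · exact (hpos n h).ge
  have hαx : ∀ n, α n * x n = (b - a * X - a * x n) * x n := by
    intro n
    rcases (hx0 n).eq_or_lt with h | h
    · rw [← h]; simp
    · rw [hpos n h]
  have hαk : ∀ n, α k ≤ α n := by
    intro n
    rw [hpos k hxk]
    have := mul_le_mul_of_nonneg_left (hk n) ha.le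
    linarith [hαge n]
  have hinf : ⨅ n, α n = α k :=
    le_antisymm (ciInf_le (Set.finite_range α).bddBelow k) (le_ciInf hαk)
  have hαk0 : 0 ≤ α k := by
    have h1 := aux_tangent (hC k) hxk.le (y := x k / 2) (by linarith)
    have h2 : C k (x k / 2) ≤ C k (x k) :=
      (hC k).2.2.1 (Set.mem_Ici.2 (by linarith)) (Set.mem_Ici.2 hxk.le) (by linarith)
    rw [hα]
    by_contra hc
    push Not at hc
    nlinarith
  have hkX : x k ≤ X := Finset.single_le_sum (fun i _ => hx0 i) (Finset.mem_univ k)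
  have hbm : b - α k = a * (X + x k) := by rw [hpos k hxk]; ring
  have hS : 0 < X + x k := by linarith
  have hβ' : β = X / (X + x k) := by
    rw [hβ, hinf, hbm, mul_div_mul_left _ _ ha.ne']
  refine ⟨⟨?_, ?_⟩, ?_⟩
  · rw [hβ', div_le_div_iff₀ (by norm_num) hS]; linarith
  · rw [hβ', div_lt_one hS]; linarith
  intro xS hxS
  have hβl : 1 / 2 ≤ β := by
    rw [hβ', div_le_div_iff₀ (by norm_num) hS]; linarith
  have hβr : β < 1 := by
    rw [hβ', div_lt_one hS]; linarith
  set g := 3 * β ^ 2 - 4 * β + 2 with hg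
  have hg1 : g ≤ 1 := by nlinarith
  have hg0 : 0 ≤ g := by nlinarith [sq_nonneg (3 * β - 2)]
  set D := ∑ n, (α n * x n - C n (x n)) with hD
  have hD0 : 0 ≤ D := by
    apply Finset.sum_nonneg
    intro n _
    have := aux_tangent (hC n) (hx0 n) le_rfl
    rw [← hα, hC0] at this
    linarith
  set Q := ∑ n, x n ^ 2 with hQ
  have hQk : x k ^ 2 ≤ Q :=
    Finset.single_le_sum (f := fun n => x n ^ 2) (fun i _ => sq_nonneg _) (Finset.mem_univ k)
  have hsum : ∑ n, α n * x n = (b - a * X) * X - a * Q := by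
    have h1 : (b - a * X) * X = ∑ n, (b - a * X) * x n := by
      rw [← Finset.mul_sum]
    have h2 : a * Q = ∑ n, a * x n ^ 2 := by
      rw [hQ, Finset.mul_sum]
    rw [h1, h2, ← Finset.sum_sub_distrib]
    apply Finset.sum_congr rfl
    intro n _
    rw [hαx]; ring
  have hDs : D = (b - a * X) * X - a * Q - ∑ n, C n (x n) := by
    rw [hD, Finset.sum_sub_distrib, hsum]
  have hSWx : SW C (fun q => max (b - a * q) 0) x = a * X ^ 2 / 2 + a * Q + D := by
    unfold SW
    rw [← hX, aux_int1 ha hX0 hXle, hDs]; ring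
  have hSWS : SW C (fun q => max (b - a * q) 0) xS ≤ a * (X + x k) ^ 2 / 2 + D := by
    have hY0 : 0 ≤ ∑ n, xS n := Finset.sum_nonneg fun n _ => hxS.1 n
    have h1 := aux_int_le ha hb hY0 hαk0
    have h2 : α k * (∑ n, xS n) - D ≤ ∑ n, C n (xS n) := by
      rw [hD, Finset.mul_sum, ← Finset.sum_sub_distrib]
      apply Finset.sum_le_sum
      intro n _
      have h3 := aux_tangent (hC n) (hx0 n) (hxS.1 n)
      rw [← hα] at h3
      have := mul_le_mul_of_nonneg_right (hαk n) (hxS.1 n)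
      linarith
    have h4 : (b - α k) ^ 2 / (2 * a) = a * (X + x k) ^ 2 / 2 := by
      rw [hbm]; field_simp
    unfold SW
    linarith
  have hSWle := hxS.2 x hx0
  have hQ0 : 0 ≤ Q := (sq_nonneg _).trans hQk
  have hSWpos : 0 < SW C (fun q => max (b - a * q) 0) x := by
    rw [hSWx]; positivity
  rw [le_div_iff₀ (hSWpos.trans_le hSWle)]
  have e1 : g * (a * (X + x k) ^ 2 / 2) = a * X ^ 2 / 2 + a * x k ^ 2 := by
    rw [hg, hβ']; field_simp; ring
  have e2 := mul_le_mul_of_nonneg_left hSWS hg0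
  have e3 := mul_le_mul_of_nonneg_right hg1 hD0
  have e4 := mul_le_mul_of_nonneg_left hQk ha.le
  rw [hSWx]
  linarith

end
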